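/- Let A and C be atoms, U a variable with U ∉ Var(A), and t a term. If A and C{U/t} are unifiable, then A and C are unifiable. (Hence replacing a subterm of an atom in the working set by a fresh variable preserves unifiability with the input atom, which is part (a) of the invariant of the maximal-unifying-substitution algorithm.) -/

import Mathlib

/- A model of first-order terms/atoms (atoms are modeled as terms with a
distinguished top symbol) and finitely supported substitutions, following
the standard conventions of logic programming. -/

namespace Concolic

open FirstOrder Language

variable {L : FirstOrder.Language} {V : Type} [DecidableEq V]

/-- A substitution: a map from variables to terms (the finite-support
condition is stated separately as `IsSubst`). -/
abbrev Subst (L : FirstOrder.Language) (V : Type) : Type _ := V → L.Term V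

/-- The domain of a substitution: the variables it moves. -/
def dom (σ : Subst L V) : Set V := {x | σ x ≠ Term.var x}

/-- The set of variables of a term (or atom). -/
def vars (t : L.Term V) : Set V := ↑t.varFinset

/-- The range of a substitution: variables occurring in images of its domain. -/
def ran (σ : Subst L V) : Set V := ⋃ x ∈ dom σ, vars (σ x)

/-- Var(θ) = Dom(θ) ∪ Ran(θ). -/
def varsSubst (σ : Subst L V) : Set V := dom σ ∪ ran σ

/-- Composition of substitutions: `comp θ η` applies θ first, then η. -/
def comp (θ η : Subst L V) : Subst L V := fun x => (θ x).subst η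

/-- A substitution is finitely supported: identity on all but finitely many variables. -/
def IsSubst (σ : Subst L V) : Prop := (dom σ).Finite

/-- θ is idempotent if θθ = θ. -/
def Idempotent (σ : Subst L V) : Prop := comp σ σ = σ

/-- The substitution {X/t} mapping X to t and every other variable to itself. -/
def single (X : V) (t : L.Term V) : Subst L V := fun y => if y = X then t else Term.var y

/-- Atoms A and B are unifiable if Aσ = Bσ for some substitution σ. -/
def Unifiable (A B : L.Term V) : Prop := ∃ σ : Subst L V, IsSubst σ ∧ A.subst σ = B.subst σ

/-- s₁ is more general than s₂ (s₁ ≤ s₂) if s₁θ = s₂ for some substitution θ. -/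
def MoreGen (s₁ s₂ : L.Term V) : Prop := ∃ σ : Subst L V, IsSubst σ ∧ s₁.subst σ = s₂

/-- σ is a most general unifier of A and H. -/
def IsMGU (σ : Subst L V) (A H : L.Term V) : Prop :=
  IsSubst σ ∧ A.subst σ = H.subst σ ∧
    ∀ θ : Subst L V, IsSubst θ → A.subst θ = H.subst θ →
      ∃ δ : Subst L V, IsSubst δ ∧ θ = comp σ δ

/-- The variables of a set of atoms. -/
def varsSet (𝓑 : Set (L.Term V)) : Set V := ⋃ B ∈ 𝓑, vars B

/-- A term is ground if it contains no variables. -/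
def Ground (t : L.Term V) : Prop := t.varFinset = ∅

end Concolic

namespace Concolic

theorem subst_comp {L : FirstOrder.Language} {V : Type} (s : L.Term V) (θ η : Subst L V) :
    s.subst (comp θ η) = (s.subst θ).subst η := by
  induction s with
  | var x => rfl
  | func f ts ih => simp [FirstOrder.Language.Term.subst, ih]

theorem subst_single_of_notMem_vars {L : FirstOrder.Language} {V : Type} [DecidableEq V]
    {s : L.Term V} {U : V} (hU : U ∉ vars s) (t : L.Term V) : s.subst (single U t) = s := by
  induction s with
  | var x =>
    have hx : x ≠ U := by
      rintro rfl
      exact hU (by simp [vars, FirstOrder.Language.Term.varFinset])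
    simp [FirstOrder.Language.Term.subst, single, hx]
  | func f ts ih =>
    have hts : ∀ i, U ∉ vars (ts i) := by
      simpa [vars, FirstOrder.Language.Term.varFinset] using hU
    simp [FirstOrder.Language.Term.subst, ih _ (hts _)]

theorem IsSubst.single_comp {L : FirstOrder.Language} {V : Type} [DecidableEq V]
    {σ : Subst L V} (hσ : IsSubst σ) (U : V) (t : L.Term V) : IsSubst (comp (single U t) σ) := by
  refine (hσ.insert U).subset fun x hx => ?_
  by_cases hxU : x = U
  · exact Or.inl hxU
  · exact Or.inr (by simpa [dom, comp, single, hxU, FirstOrder.Language.Term.subst] using hx)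

/-- if U ∉ Var(A) and A unifies with C{U/t}, then A unifies with C. -/
theorem stmt5 {L : FirstOrder.Language} {V : Type} [DecidableEq V]
    (A C : L.Term V) (U : V) (hU : U ∉ vars A) (t : L.Term V)
    (h : Unifiable A (C.subst (single U t))) : Unifiable A C := by
  obtain ⟨σ, hσ, hAC⟩ := h
  refine ⟨comp (single U t) σ, hσ.single_comp U t, ?_⟩
  rw [subst_comp, subst_comp, subst_single_of_notMem_vars hU, hAC]

end Concolic
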